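/- Let (M_p)_{p∈ℕ₀} be a sequence of positive real numbers and let φ : ℝ^d → ℂ be a smooth function. Then the following are equivalent: (i) there exists h > 0 such that sup_{k∈ℕ₀^d} ‖D^kφ‖_∞ / (h^{|k|} M_{|k|}) < ∞; (ii) for every (r_p) ∈ 𝔯, sup_{k∈ℕ₀^d} ‖D^kφ‖_∞ / (R_{|k|} M_{|k|}) < ∞, where (R_p) is the product sequence corresponding to (r_p). (This is the membership form of the projective description 𝒟_{L^∞}^{{M_p}} = proj lim_{(r_p)∈𝔯} 𝒟_{L^∞,(r_p)}^{{M_p}}.) -/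

import Mathlib

open scoped ENNReal

noncomputable section

/-- The class 𝔯: positive sequences with `r 0 = 1`, monotonically increasing,
tending to infinity. -/
def IsRSeq (r : ℕ → ℝ) : Prop :=
  r 0 = 1 ∧ (∀ p, 0 < r p) ∧ Monotone r ∧ Filter.Tendsto r Filter.atTop Filter.atTop

/-- The product sequence `R p = r 0 * r 1 * ⋯ * r p` (so `R 0 = r 0 = 1`). -/
def prodSeq (r : ℕ → ℝ) (p : ℕ) : ℝ := ∏ i ∈ Finset.range (p + 1), r i

/-- The one-dimensional operator `D_m = (1/i) ∂/∂x_m` acting on functions on `ℝ^d`. -/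
def Dm {d : ℕ} (m : Fin d) (f : (Fin d → ℝ) → ℂ) : (Fin d → ℝ) → ℂ :=
  fun x => -Complex.I * fderiv ℝ f x (Pi.single m 1)

/-- The multi-index derivative `D^k = D_1^{k_1} ⋯ D_d^{k_d}`. -/
def Dmulti {d : ℕ} (k : Fin d → ℕ) (f : (Fin d → ℝ) → ℂ) : (Fin d → ℝ) → ℂ :=
  ((List.ofFn fun m : Fin d => (Dm m)^[k m]).foldr (· ∘ ·) id) f

lemma aux_fin (b : ℕ → ℝ≥0∞) (hb : ∀ p, b p < ⊤) (w : ℕ → ℝ) (hw : ∀ p, 0 < w p)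
    (C : ℝ) (hC : 0 ≤ C) (N : ℕ) (h : ∀ p, N ≤ p → b p ≤ ENNReal.ofReal (C * w p)) :
    ∃ C' : ℝ, 0 ≤ C' ∧ ∀ p, b p ≤ ENNReal.ofReal (C' * w p) := by
  have hnn : ∀ p, 0 ≤ (b p).toReal / w p := fun p => div_nonneg ENNReal.toReal_nonneg (hw p).le
  have hs : 0 ≤ ∑ p ∈ Finset.range N, (b p).toReal / w p := Finset.sum_nonneg fun p _ => hnn p
  refine ⟨C + ∑ p ∈ Finset.range N, (b p).toReal / w p, by positivity, fun p => ?_⟩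
  rcases le_or_gt N p with hp | hp
  · refine (h p hp).trans (ENNReal.ofReal_le_ofReal ?_)
    exact mul_le_mul_of_nonneg_right (by linarith) (hw p).le
  · rw [← ENNReal.ofReal_toReal (hb p).ne]
    apply ENNReal.ofReal_le_ofReal
    rw [← div_le_iff₀ (hw p)]
    have := Finset.single_le_sum (f := fun p => (b p).toReal / w p) (fun i _ => hnn i)
      (Finset.mem_range.2 hp)
    linarith

lemma aux_sup {ι : Type} (a : ι → ℝ≥0∞) (s : ι → ℕ) (M w : ℕ → ℝ) (hM : ∀ p, 0 < M p)
    (hw : ∀ p, 0 < w p) :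
    (⨆ k, a k / ENNReal.ofReal (w (s k) * M (s k))) < ⊤ ↔
      ∃ C : ℝ, 0 ≤ C ∧ ∀ p, (⨆ k, ⨆ _ : s k = p, a k / ENNReal.ofReal (M p)) ≤
        ENNReal.ofReal (C * w p) := by
  have key : ∀ (C : ℝ), 0 ≤ C → ∀ k, (a k / ENNReal.ofReal (w (s k) * M (s k)) ≤ ENNReal.ofReal C ↔
      a k / ENNReal.ofReal (M (s k)) ≤ ENNReal.ofReal (C * w (s k))) := by
    intro C hC k
    have h1 := hM (s k)
    have h2 := hw (s k)
    rw [ENNReal.div_le_iff (by simpa using mul_pos h2 h1) ENNReal.ofReal_ne_top,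
      ENNReal.div_le_iff (by simpa using h1) ENNReal.ofReal_ne_top,
      ← ENNReal.ofReal_mul hC, ← ENNReal.ofReal_mul (by positivity), mul_assoc]
  constructor
  · intro h
    refine ⟨_, ENNReal.toReal_nonneg (a := ⨆ k, a k / ENNReal.ofReal (w (s k) * M (s k))), ?_⟩
    intro p
    refine iSup_le fun k => iSup_le ?_
    rintro rfl
    rw [← key _ ENNReal.toReal_nonneg, ENNReal.ofReal_toReal h.ne]
    exact le_iSup (fun k => a k / ENNReal.ofReal (w (s k) * M (s k))) k
  · rintro ⟨C, hC, h⟩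
    refine lt_of_le_of_lt (iSup_le fun k => (key C hC k).2 ?_) (ENNReal.ofReal_lt_top (r := C))
    refine le_trans ?_ (h (s k))
    exact le_iSup₂ (f := fun k' (_ : s k' = s k) => a k' / ENNReal.ofReal (M (s k))) k rfl

lemma prodSeq_pos {r : ℕ → ℝ} (hr : IsRSeq r) (p : ℕ) : 0 < prodSeq r p :=
  Finset.prod_pos fun i _ => hr.2.1 i

lemma prodSeq_le {r : ℕ → ℝ} (hr : IsRSeq r) (p : ℕ) : prodSeq r p ≤ r p ^ p := by
  unfold prodSeq
  rw [Finset.prod_range_succ', hr.1, mul_one]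
  calc _ ≤ ∏ i ∈ Finset.range p, r p := by
        refine Finset.prod_le_prod (fun i _ => (hr.2.1 _).le) fun i hi => hr.2.2.1 ?_
        have := Finset.mem_range.1 hi
        omega
    _ = _ := by simp

lemma pow_le_prodSeq {r : ℕ → ℝ} (hr : IsRSeq r) (h : ℝ) (hh : 0 < h) :
    ∃ C : ℝ, 0 ≤ C ∧ ∀ p, h ^ p ≤ C * prodSeq r p := by
  obtain ⟨N, hN⟩ := Filter.eventually_atTop.1 (hr.2.2.2.eventually_ge_atTop h)
  have hR := prodSeq_pos hr
  have hC : 0 ≤ h ^ N / prodSeq r N := div_nonneg (by positivity) (hR N).le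
  have h1 : ∀ p, N ≤ p → h ^ p ≤ h ^ N / prodSeq r N * prodSeq r p := by
    intro p hp
    induction p, hp using Nat.le_induction with
    | base => rw [div_mul_cancel₀ _ (hR N).ne']
    | succ p hp ih =>
      have : prodSeq r (p+1) = prodSeq r p * r (p+1) := Finset.prod_range_succ _ _
      rw [this, pow_succ, ← mul_assoc]
      exact mul_le_mul ih (hN _ (by omega)) hh.le (mul_nonneg hC (hR p).le)
  obtain ⟨C, hC, h2⟩ := aux_fin (fun p => ENNReal.ofReal (h ^ p)) (fun p => ENNReal.ofReal_lt_top)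
    (prodSeq r) hR _ hC N (fun p hp => ENNReal.ofReal_le_ofReal (h1 p hp))
  refine ⟨C, hC, fun p => ?_⟩
  exact (ENNReal.ofReal_le_ofReal_iff (mul_nonneg hC (hR p).le)).1 (h2 p)

lemma aux_main (b : ℕ → ℝ≥0∞) :
    (∃ h : ℝ, 0 < h ∧ ∃ C : ℝ, 0 ≤ C ∧ ∀ p, b p ≤ ENNReal.ofReal (C * h ^ p)) ↔
    ∀ r, IsRSeq r → ∃ C : ℝ, 0 ≤ C ∧ ∀ p, b p ≤ ENNReal.ofReal (C * prodSeq r p) := by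
  constructor
  · rintro ⟨h, hh, C, hC, H⟩ r hr
    obtain ⟨C', hC', H'⟩ := pow_le_prodSeq hr h hh
    refine ⟨C * C', by positivity, fun p => (H p).trans (ENNReal.ofReal_le_ofReal ?_)⟩
    rw [mul_assoc]
    exact mul_le_mul_of_nonneg_left (H' p) hC
  · intro H
    have hfin : ∀ p, b p < ⊤ := by
      intro p
      obtain ⟨C, -, h⟩ := H (fun p => (p : ℝ) + 1) ⟨by simp, fun p => by positivity,
        fun p q hpq => by
          have : (p : ℝ) ≤ q := by exact_mod_cast hpq
          simpa using this,
        Filter.tendsto_atTop_add_const_right _ _ tendsto_natCast_atTop_atTop⟩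
      exact (h p).trans_lt ENNReal.ofReal_lt_top
    by_contra hcon
    have hfreq : ∀ n : ℕ, ∃ᶠ p in Filter.atTop,
        ENNReal.ofReal (((n : ℝ) + 1) * ((n : ℝ) + 1) ^ p) < b p := by
      intro n
      by_contra hn
      rw [Filter.not_frequently] at hn
      obtain ⟨N, hN⟩ := Filter.eventually_atTop.1 hn
      exact hcon ⟨(n : ℝ) + 1, by positivity, aux_fin b hfin (fun p => ((n : ℝ) + 1) ^ p)
        (fun p => by positivity) ((n : ℝ) + 1) (by positivity) N (fun p hp => not_lt.1 (hN p hp))⟩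
    obtain ⟨P, hP, hPb⟩ := Filter.extraction_forall_of_frequently hfreq
    let q : ℕ → ℕ := fun p => ((Finset.range p).filter (fun n => P n < p)).card
    have hq0 : q 0 = 0 := by simp [q]
    have hqm : Monotone q := by
      intro x y hxy
      apply Finset.card_le_card
      intro n
      simp only [Finset.mem_filter, Finset.mem_range]
      omega
    have hqP : ∀ n, q (P n) = n := by
      intro n
      have : (Finset.range (P n)).filter (fun m => P m < P n) = Finset.range n := by
        ext m
        simp only [Finset.mem_filter, Finset.mem_range, hP.lt_iff_lt]
        have := hP.le_apply (x := n)
        omega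
      simp only [q, this, Finset.card_range]
    have hqt : Filter.Tendsto q Filter.atTop Filter.atTop :=
      Filter.tendsto_atTop_atTop_of_monotone hqm fun n => ⟨P n, (hqP n).ge⟩
    have hr : IsRSeq (fun p => (q p : ℝ) + 1) := by
      refine ⟨by simp [hq0], fun p => by positivity, fun x y hxy => ?_,
        Filter.tendsto_atTop_add_const_right _ _ (tendsto_natCast_atTop_atTop.comp hqt)⟩
      have : (q x : ℝ) ≤ q y := by exact_mod_cast hqm hxy
      simpa using this
    obtain ⟨C, hC, hb⟩ := H _ hr
    obtain ⟨n, hn⟩ := exists_nat_gt C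
    have h1 := (hPb n).trans_le (hb (P n))
    have h2 := prodSeq_le hr (P n)
    simp only [hqP] at h2
    refine absurd h1 (not_lt.2 (ENNReal.ofReal_le_ofReal ?_))
    exact mul_le_mul (by linarith) h2 (prodSeq_pos hr _).le (by positivity)

/-- Projective description of `𝒟_{L^∞}^{M_p}` (membership form): for a smooth
`φ` on `ℝ^d`, there exists `h > 0` with
`sup_k ‖D^k φ‖_∞ / (h^{|k|} M_{|k|}) < ∞` iff for every `(r p) ∈ 𝔯` one has
`sup_k ‖D^k φ‖_∞ / (R_{|k|} M_{|k|}) < ∞`. -/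
theorem stmt8 (d : ℕ) (M : ℕ → ℝ) (hM : ∀ p, 0 < M p)
    (φ : (Fin d → ℝ) → ℂ) (hφ : ContDiff ℝ (⊤ : ℕ∞) φ) :
    (∃ h : ℝ, 0 < h ∧
        (⨆ k : Fin d → ℕ, (⨆ x, (‖Dmulti k φ x‖₊ : ℝ≥0∞)) /
          ENNReal.ofReal (h ^ (∑ m, k m) * M (∑ m, k m))) < ⊤) ↔
      ∀ r : ℕ → ℝ, IsRSeq r →
        (⨆ k : Fin d → ℕ, (⨆ x, (‖Dmulti k φ x‖₊ : ℝ≥0∞)) /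
          ENNReal.ofReal (prodSeq r (∑ m, k m) * M (∑ m, k m))) < ⊤ := by
  have hsup := fun (w : ℕ → ℝ) (hw : ∀ p, 0 < w p) =>
    aux_sup (fun k : Fin d → ℕ => ⨆ x, (‖Dmulti k φ x‖₊ : ℝ≥0∞)) (fun k => ∑ m, k m) M w hM hw
  refine Iff.trans ?_ ((aux_main (fun p => ⨆ k : Fin d → ℕ, ⨆ _ : ∑ m, k m = p,
      (⨆ x, (‖Dmulti k φ x‖₊ : ℝ≥0∞)) / ENNReal.ofReal (M p))).trans ?_)
  · refine exists_congr fun h => and_congr_right fun hh => ?_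
    exact hsup (fun p => h ^ p) (fun p => by positivity)
  · refine forall_congr' fun r => forall_congr' fun hr => ?_
    exact (hsup (prodSeq r) (prodSeq_pos hr)).symm
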